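/- Let m ≥ 2 and let π be an irreducible permutation of {1,…,m}. Then the permutation b(π) = τ_{π(m)} ∘ π is again irreducible. -/

import Mathlib

/-- The permutation `τ_k` of `{1,…,m}` (0-based model: `Fin m`): it fixes the first `k`
elements `1,…,k` (0-based indices `0,…,k-1`) and cyclically moves one step forward the
remaining elements, i.e. (1-based) `i ↦ i+1` for `k+1 ≤ i ≤ m-1` and `m ↦ k+1`. -/
def tau (m k : ℕ) : Equiv.Perm (Fin m) :=
  if h : k ≤ m then
    (finSumFinEquiv.trans (finCongr (Nat.add_sub_cancel' h))).permCongr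
      (Equiv.sumCongr (Equiv.refl (Fin k)) (finRotate (m - k)))
  else 1

/-- The last element of `Fin m`, i.e. the element `m` of `{1,…,m}`. -/
def mLast (m : ℕ) (h : 0 < m) : Fin m := ⟨m - 1, by omega⟩

/-- The Rauzy map `a(π) = π ∘ τ_{π⁻¹(m)}⁻¹`. -/
def rauzyA (m : ℕ) (h : 0 < m) (π : Equiv.Perm (Fin m)) : Equiv.Perm (Fin m) :=
  π * (tau m (((π.symm (mLast m h)) : ℕ) + 1))⁻¹

/-- The Rauzy map `b(π) = τ_{π(m)} ∘ π`. -/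
def rauzyB (m : ℕ) (h : 0 < m) (π : Equiv.Perm (Fin m)) : Equiv.Perm (Fin m) :=
  tau m (((π (mLast m h)) : ℕ) + 1) * π

/-- A permutation `π` of `{1,…,m}` is irreducible if there is no `k` with `1 ≤ k < m`
such that `π({1,…,k}) = {1,…,k}` (0-based: `π` maps `{0,…,k-1}` onto itself). -/
def IrreduciblePerm {m : ℕ} (π : Equiv.Perm (Fin m)) : Prop :=
  ¬ ∃ k : ℕ, 1 ≤ k ∧ k < m ∧ ⇑π '' {i : Fin m | (i : ℕ) < k} = {i : Fin m | (i : ℕ) < k}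

/-- The order-reversing permutation `π₀(i) = m + 1 - i` of `{1,…,m}`. -/
def rev (m : ℕ) : Equiv.Perm (Fin m) where
  toFun i := ⟨m - 1 - (i : ℕ), by have := i.isLt; omega⟩
  invFun i := ⟨m - 1 - (i : ℕ), by have := i.isLt; omega⟩
  left_inv i := by have := i.isLt; apply Fin.ext; simp; omega
  right_inv i := by have := i.isLt; apply Fin.ext; simp; omega

theorem tau_fix (m k : ℕ) (i : Fin m) (hi : (i : ℕ) < k) : tau m k i = i := by
  unfold tau
  split_ifs with h
  · have hs : (finSumFinEquiv.trans (finCongr (Nat.add_sub_cancel' h))).symm i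
        = Sum.inl ⟨i, hi⟩ := by
      rw [Equiv.symm_apply_eq]
      ext
      simp
    rw [Equiv.permCongr_apply, hs]
    ext
    simp
  · rfl

/-- For `m ≥ 2`, if `π` is an irreducible permutation of `{1,…,m}` then
`b(π) = τ_{π(m)} ∘ π` is again irreducible. -/
theorem rauzyB_irreducible (m : ℕ) (hm : 2 ≤ m) (π : Equiv.Perm (Fin m))
    (hπ : IrreduciblePerm π) :
    IrreduciblePerm (rauzyB m (by omega) π) := by
  rintro ⟨k, h1, hk, him⟩
  apply hπ
  refine ⟨k, h1, hk, ?_⟩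
  have hlast : rauzyB m (by omega) π (mLast m (by omega)) = π (mLast m (by omega)) := by
    unfold rauzyB
    rw [Equiv.Perm.mul_apply]
    exact tau_fix _ _ _ (Nat.lt_succ_self _)
  have hp : k ≤ (π (mLast m (by omega)) : ℕ) := by
    by_contra hlt
    have hmem : π (mLast m (by omega)) ∈ {i : Fin m | (i : ℕ) < k} := not_le.mp hlt
    rw [← him, ← hlast] at hmem
    obtain ⟨j, hj, hje⟩ := hmem
    have := (rauzyB m (by omega) π).injective hje
    subst this
    simp [mLast] at hj
    omega
  refine Eq.trans (Set.image_congr ?_) him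
  intro i hi
  have hσ : rauzyB m (by omega) π i ∈ {i : Fin m | (i : ℕ) < k} := him ▸ ⟨i, hi, rfl⟩
  have hfix := tau_fix m ((π (mLast m (by omega)) : ℕ) + 1) (rauzyB m (by omega) π i)
    (by simp only [Set.mem_setOf_eq] at hσ; omega)
  exact ((tau m ((π (mLast m (by omega)) : ℕ) + 1)).injective hfix).symm
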